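/- arXiv:1510.09001 — 2 statements merged into one kernel-verified Lean document; each statement's English description precedes it below -/
import Mathlib

section
/- Under the stated hypotheses on the pressure, the pressure potential has γ-power growth: there exist constants c₁ > 0 and c₂, c₃, c₄ ≥ 0 such that c₁ ρ^γ − c₂ ≤ H(ρ) ≤ c₃ ρ^γ + c₄ for every ρ > 0. -/
/-- The pressure potential, normalized with base point 1:
`H(ρ) = ρ * ∫_1^ρ p(z)/z² dz`. -/
noncomputable def presPot (p : ℝ → ℝ) (ρ : ℝ) : ℝ :=
  ρ * ∫ z in (1:ℝ)..ρ, p z / z ^ 2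

lemma aux_cont (p : ℝ → ℝ) (hp1 : ContDiffOn ℝ 1 p (Set.Ici 0)) (a b : ℝ) (ha : 0 < a) (hb : 0 < b) :
    IntervalIntegrable (fun z => p z / z ^ 2) MeasureTheory.volume a b := by
  apply ContinuousOn.intervalIntegrable
  have hs : ∀ z ∈ Set.uIcc a b, 0 < z := fun z hz =>
    lt_of_lt_of_le (lt_min ha hb) hz.1
  apply ContinuousOn.div
  · exact hp1.continuousOn.mono (fun z hz => (hs z hz).le)
  · fun_prop
  · intro z hz
    have := hs z hz
    positivity

/-- linear bound near zero -/
lemma aux_lin (p : ℝ → ℝ) (hp1 : ContDiffOn ℝ 1 p (Set.Ici 0)) (hp0 : p 0 = 0) :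
    ∃ C : ℝ, 0 ≤ C ∧ ∀ z, 0 < z → z ≤ 1 → p z ≤ C * z := by
  have h1 : ContDiffOn ℝ 1 p (Set.Icc 0 1) := hp1.mono Set.Icc_subset_Ici_self
  have hl : LocallyLipschitzOn (Set.Icc (0:ℝ) 1) p := h1.locallyLipschitzOn (convex_Icc 0 1)
  obtain ⟨K, hK⟩ := hl.exists_lipschitzOnWith_of_compact isCompact_Icc
  refine ⟨K, K.2, fun z hz hz1 => ?_⟩
  have := hK.dist_le_mul z ⟨hz.le, hz1⟩ 0 ⟨le_rfl, zero_le_one⟩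
  rw [hp0, Real.dist_eq, Real.dist_eq, sub_zero, sub_zero, abs_of_pos hz] at this
  exact (le_abs_self _).trans this

lemma aux_bounds (p : ℝ → ℝ) (γ pinf : ℝ)
    (hp1 : ContDiffOn ℝ 1 p (Set.Ici 0))
    (hp3 : ContDiffOn ℝ 3 p (Set.Ioi 0))
    (hp0 : p 0 = 0)
    (hp' : ∀ ρ > (0:ℝ), 0 < deriv p ρ)
    (hγ : (3:ℝ)/2 < γ) (hpinf : 0 < pinf)
    (hlim : Filter.Tendsto (fun ρ : ℝ => deriv p ρ / ρ ^ (γ - 1))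
      Filter.atTop (nhds pinf)) :
    ∃ A B K : ℝ, 0 < A ∧ 0 < B ∧ 0 ≤ K ∧ ∀ z, 0 < z →
      0 ≤ p z ∧ A * z ^ γ - K ≤ p z ∧ p z ≤ B * z ^ γ + K := by
  have hd : ∀ z, 0 < z → HasDerivAt p (deriv p z) z := fun z hz =>
    ((hp3.contDiffAt (Ioi_mem_nhds hz)).differentiableAt (by norm_num)).hasDerivAt
  have hmono : MonotoneOn p (Set.Ici 0) := by
    apply monotoneOn_of_deriv_nonneg (convex_Ici 0) hp1.continuousOn
    · rw [interior_Ici]; exact fun z hz => (hd z hz).differentiableAt.differentiableWithinAt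
    · rw [interior_Ici]; exact fun z hz => (hp' z hz).le
  have hnn : ∀ z, 0 < z → 0 ≤ p z := fun z hz => by
    rw [← hp0]; exact hmono (Set.mem_Ici.2 le_rfl) hz.le hz.le
  have e1 := hlim.eventually (lt_mem_nhds (show pinf / 2 < pinf by linarith))
  have e2 := hlim.eventually (gt_mem_nhds (show pinf < 2 * pinf by linarith))
  obtain ⟨R0, hR0⟩ := Filter.eventually_atTop.1 (e1.and e2)
  set R := max R0 1 with hR
  have hRpos : 0 < R := lt_of_lt_of_le one_pos (le_max_right _ _)
  have hb : ∀ z, R ≤ z → pinf / 2 * z ^ (γ-1) ≤ deriv p z ∧ deriv p z ≤ 2 * pinf * z ^ (γ-1) := by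
    intro z hz
    have hz0 : 0 < z := hRpos.trans_le hz
    have h := hR0 z ((le_max_left _ _).trans hz)
    have hq : 0 < z ^ (γ-1) := Real.rpow_pos_of_pos hz0 _
    exact ⟨((lt_div_iff₀ hq).1 h.1).le, ((div_lt_iff₀ hq).1 h.2).le⟩
  have hγ0 : 0 < γ := by linarith
  have hdr : ∀ c z, 0 < z → HasDerivAt (fun z => c / γ * z ^ γ) (c * z ^ (γ-1)) z := by
    intro c z hz
    have := (Real.hasDerivAt_rpow_const (x := z) (p := γ) (Or.inl hz.ne')).const_mul (c / γ)
    rw [← mul_assoc, div_mul_cancel₀ _ hγ0.ne'] at this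
    exact this
  have key : ∀ f f' : ℝ → ℝ, (∀ z, 0 < z → HasDerivAt f (f' z) z) → (∀ z, R ≤ z → 0 ≤ f' z) →
      ∀ z, R ≤ z → f R ≤ f z := by
    intro f f' hf hf' z hz
    have : MonotoneOn f (Set.Ici R) := by
      apply monotoneOn_of_deriv_nonneg (convex_Ici R)
      · exact fun z hz => (hf z (hRpos.trans_le hz)).continuousAt.continuousWithinAt
      · rw [interior_Ici]
        exact fun z hz => (hf z (hRpos.trans hz)).differentiableAt.differentiableWithinAt
      · rw [interior_Ici]
        intro z hz
        rw [(hf z (hRpos.trans hz)).deriv]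
        exact hf' z (le_of_lt hz)
    exact this (Set.mem_Ici.2 le_rfl) hz hz
  have hRγ : 0 < R ^ γ := Real.rpow_pos_of_pos hRpos _
  have hpR := hnn R hRpos
  refine ⟨pinf / 2 / γ, 2 * pinf / γ, p R + pinf / 2 / γ * R ^ γ, by positivity, by positivity,
    by positivity, fun z hz => ⟨hnn z hz, ?_, ?_⟩⟩
  · rcases le_total R z with h | h
    · have := key (fun z => p z - pinf / 2 / γ * z ^ γ) _
        (fun z hz => (hd z hz).sub (hdr (pinf / 2) z hz)) (fun z hz => by linarith [(hb z hz).1]) z h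

      linarith
    · have h2 : z ^ γ ≤ R ^ γ := Real.rpow_le_rpow hz.le h hγ0.le
      have h3 : pinf / 2 / γ * z ^ γ ≤ pinf / 2 / γ * R ^ γ := by gcongr
      linarith [hnn z hz]
  · rcases le_total R z with h | h
    · have := key (fun z => 2 * pinf / γ * z ^ γ - p z) _
        (fun z hz => (hdr (2 * pinf) z hz).sub (hd z hz)) (fun z hz => by linarith [(hb z hz).2]) z h

      have h4 : 0 < 2 * pinf / γ * R ^ γ := by positivity
      have h5 : 0 < pinf / 2 / γ * R ^ γ := by positivity
      linarith
    · have h2 := hmono hz.le hRpos.le h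
      have h4 : 0 < 2 * pinf / γ * z ^ γ := by positivity
      have h5 : 0 < pinf / 2 / γ * R ^ γ := by positivity
      linarith

lemma aux_int (γ A K ρ : ℝ) (hγ : (3:ℝ)/2 < γ) (hρ : 1 ≤ ρ) :
    IntervalIntegrable (fun z : ℝ => A * z ^ (γ-2) + K * z ^ (-2:ℝ)) MeasureTheory.volume 1 ρ ∧
    ∫ z in (1:ℝ)..ρ, (A * z ^ (γ-2) + K * z ^ (-2:ℝ))
      = A * ((ρ ^ (γ-1) - 1) / (γ-1)) + K * (1 - ρ⁻¹) := by
  have h0 : (0:ℝ) ∉ Set.uIcc 1 ρ := by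
    rw [Set.uIcc_of_le hρ]; intro h; linarith [h.1]
  have i1 : IntervalIntegrable (fun z : ℝ => A * z ^ (γ-2)) MeasureTheory.volume 1 ρ :=
    (intervalIntegral.intervalIntegrable_rpow (Or.inr h0)).const_mul A
  have i2 : IntervalIntegrable (fun z : ℝ => K * z ^ (-2:ℝ)) MeasureTheory.volume 1 ρ :=
    (intervalIntegral.intervalIntegrable_rpow (Or.inr h0)).const_mul K
  refine ⟨i1.add i2, ?_⟩
  rw [intervalIntegral.integral_add i1 i2, intervalIntegral.integral_const_mul,
    intervalIntegral.integral_const_mul, integral_rpow (Or.inl (by linarith)),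
    integral_rpow (Or.inr ⟨by norm_num, h0⟩)]
  have e1 : γ - 2 + 1 = γ - 1 := by ring
  have e2 : (-2:ℝ) + 1 = -1 := by norm_num
  rw [e1, e2, Real.rpow_neg_one, Real.one_rpow, Real.one_rpow]
  ring

theorem pressure_potential_growth
    (p : ℝ → ℝ) (γ pinf : ℝ)
    (hp1 : ContDiffOn ℝ 1 p (Set.Ici 0))
    (hp3 : ContDiffOn ℝ 3 p (Set.Ioi 0))
    (hp0 : p 0 = 0)
    (hp' : ∀ ρ > (0:ℝ), 0 < deriv p ρ)
    (hγ : (3:ℝ)/2 < γ) (hpinf : 0 < pinf)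
    (hlim : Filter.Tendsto (fun ρ : ℝ => deriv p ρ / ρ ^ (γ - 1))
      Filter.atTop (nhds pinf)) :
    ∃ c₁ c₂ c₃ c₄ : ℝ, 0 < c₁ ∧ 0 ≤ c₂ ∧ 0 ≤ c₃ ∧ 0 ≤ c₄ ∧
      ∀ ρ > (0:ℝ), c₁ * ρ ^ γ - c₂ ≤ presPot p ρ ∧ presPot p ρ ≤ c₃ * ρ ^ γ + c₄ := by
  obtain ⟨C, hC, hlin⟩ := aux_lin p hp1 hp0
  obtain ⟨A, B, K, hA, hB, hK, hbd⟩ := aux_bounds p γ pinf hp1 hp3 hp0 hp' hγ hpinf hlim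
  have hg1 : 0 < γ - 1 := by linarith
  set a := A / (γ - 1) with ha
  have ha0 : 0 < a := by positivity
  -- absorb the linear term
  obtain ⟨M, hM0, hM⟩ : ∃ M : ℝ, 0 ≤ M ∧ ∀ ρ : ℝ, 0 < ρ → (a + K) * ρ ≤ a / 2 * ρ ^ γ + M := by
    have ht := (tendsto_rpow_atTop hg1).eventually (Filter.eventually_ge_atTop ((a + K) / (a / 2)))
    obtain ⟨R, hR⟩ := Filter.eventually_atTop.1 ht
    refine ⟨(a + K) * |R|, by positivity, fun ρ hρ => ?_⟩
    rcases le_total R ρ with h | h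
    · have h1 := hR ρ h
      rw [div_le_iff₀ (by positivity)] at h1
      have h2 : ρ ^ γ = ρ ^ (γ - 1) * ρ := by
        rw [← Real.rpow_add_one hρ.ne']; ring_nf
      have h3 : 0 ≤ (a + K) * |R| := by positivity
      rw [h2]
      nlinarith [mul_le_mul_of_nonneg_right h1 hρ.le]
    · have h1 : ρ ≤ |R| := h.trans (le_abs_self _)
      have h2 : (a + K) * ρ ≤ (a + K) * |R| := by gcongr
      have h3 : 0 < a / 2 * ρ ^ γ := by positivity
      linarith
  refine ⟨a / 2, M + a / 2 + C, B / (γ - 1) + a / 2, M, by positivity, by positivity,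
    by positivity, hM0, fun ρ hρ => ?_⟩
  have hργ : 0 < ρ ^ γ := Real.rpow_pos_of_pos hρ _
  have hint := aux_cont p hp1 1 ρ one_pos hρ
  unfold presPot
  rcases le_total 1 ρ with h | h
  · have h2 : ρ ^ γ = ρ * ρ ^ (γ - 1) := by
      rw [mul_comm, ← Real.rpow_add_one hρ.ne']; ring_nf
    have hpt : ∀ (D L z : ℝ), 0 < z →
        D * z ^ (γ - 2) + L * z ^ (-2:ℝ) = (D * z ^ γ + L) / z ^ 2 := by
      intro D L z hz
      rw [Real.rpow_sub hz, Real.rpow_neg hz.le, Real.rpow_two]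
      field_simp
    have hMρ := hM ρ hρ
    have ham : a * (γ - 1) = A := by rw [ha]; field_simp
    obtain ⟨j1, k1⟩ := aux_int γ A (-K) ρ hγ h
    obtain ⟨j2, k2⟩ := aux_int γ B K ρ hγ h
    have l1 := intervalIntegral.integral_mono_on h j1 hint (fun z hz => by
      have hz0 : 0 < z := one_pos.trans_le hz.1
      rw [hpt _ _ _ hz0]
      have := (hbd z hz0).2.1
      gcongr
      linarith)
    have l2 := intervalIntegral.integral_mono_on h hint j2 (fun z hz => by
      have hz0 : 0 < z := one_pos.trans_le hz.1
      rw [hpt _ _ _ hz0]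
      have := (hbd z hz0).2.2
      gcongr)
    rw [k1] at l1
    rw [k2] at l2
    have m1 := mul_le_mul_of_nonneg_left l1 hρ.le
    have m2 := mul_le_mul_of_nonneg_left l2 hρ.le
    have r1 : ρ * (A * ((ρ ^ (γ-1) - 1) / (γ-1)) + -K * (1 - ρ⁻¹))
        = a * ρ ^ γ - a * ρ - K * ρ + K := by
      rw [h2, ha]; field_simp; ring
    have r2 : ρ * (B * ((ρ ^ (γ-1) - 1) / (γ-1)) + K * (1 - ρ⁻¹))
        = B / (γ - 1) * ρ ^ γ - B / (γ - 1) * ρ + K * ρ - K := by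
      rw [h2]; field_simp; ring
    rw [r1] at m1
    rw [r2] at m2
    have q1 : 0 < B / (γ - 1) * ρ := by positivity
    have q2 : 0 < a * ρ := by positivity
    constructor
    · linarith
    · linarith
  · have hs : ∫ z in (1:ℝ)..ρ, p z / z ^ 2 = -∫ z in ρ..(1:ℝ), p z / z ^ 2 :=
      intervalIntegral.integral_symm _ _
    have n1 : 0 ≤ ∫ z in ρ..(1:ℝ), p z / z ^ 2 :=
      intervalIntegral.integral_nonneg h (fun z hz =>
        div_nonneg (hbd z (hρ.trans_le hz.1)).1 (sq_nonneg z))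
    have h0 : (0:ℝ) ∉ Set.uIcc ρ 1 := by
      rw [Set.uIcc_of_le h]; intro h; linarith [h.1]
    have j : IntervalIntegrable (fun z : ℝ => C * z⁻¹) MeasureTheory.volume ρ 1 := by
      apply IntervalIntegrable.const_mul
      apply intervalIntegral.intervalIntegrable_inv _ continuousOn_id
      intro z hz h00
      exact h0 (h00 ▸ hz)
    have n2 := intervalIntegral.integral_mono_on h hint.symm j (fun z hz => by
      have hz0 : 0 < z := hρ.trans_le hz.1
      have := hlin z hz0 hz.2
      rw [div_le_iff₀ (by positivity)]
      calc p z ≤ C * z := this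
        _ = C * z⁻¹ * z ^ 2 := by field_simp)
    rw [intervalIntegral.integral_const_mul, integral_inv_of_pos hρ one_pos, one_div] at n2
    have n3 : Real.log ρ⁻¹ ≤ ρ⁻¹ := by
      linarith [Real.log_le_sub_one_of_pos (inv_pos.2 hρ)]
    have n4 : ρ * ∫ z in ρ..(1:ℝ), p z / z ^ 2 ≤ C := by
      calc ρ * ∫ z in ρ..(1:ℝ), p z / z ^ 2 ≤ ρ * (C * ρ⁻¹) := by
            gcongr
            exact n2.trans (by gcongr)
        _ = C := by field_simp
    have n5 := mul_nonneg hρ.le n1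
    have n6 : ρ ^ γ ≤ 1 := Real.rpow_le_one hρ.le h (by linarith)
    have n7 : a / 2 * ρ ^ γ ≤ a / 2 * 1 := by gcongr
    have n8 : 0 ≤ (B / (γ - 1) + a / 2) * ρ ^ γ := by positivity
    rw [hs, mul_neg]
    constructor <;> linarith
end

section
/- γ-growth coercivity of the relative pressure potential in the residual region: under the stated hypotheses on the pressure, for every δ ∈ (0,1) there exists a constant c(δ) > 0 such that H(ρ) − H'(r)(ρ − r) − H(r) ≥ c(δ) (1 + ρ^γ) whenever δ ≤ r ≤ δ⁻¹ and ρ > 0 lies outside the interval [δ/2, 2δ⁻¹]. -/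
/-- Tangent inequalities for a function with monotone derivative. -/
lemma aux_tangent_right (f f' : ℝ → ℝ) (a b : ℝ) (hab : a < b)
    (hf : ∀ x ∈ Set.Icc a b, HasDerivAt f (f' x) x) (hm : MonotoneOn f' (Set.Icc a b)) :
    0 ≤ f b - f' a * (b - a) - f a := by
  obtain ⟨c, hc, hc'⟩ := exists_hasDerivAt_eq_slope f f' hab
    (fun x hx => (hf x hx).continuousAt.continuousWithinAt)
    (fun x hx => hf x (Set.Ioo_subset_Icc_self hx))
  have h1 := hm (Set.left_mem_Icc.2 hab.le) (Set.Ioo_subset_Icc_self hc) hc.1.le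
  have hba : 0 < b - a := sub_pos.2 hab
  rw [eq_div_iff hba.ne'] at hc'
  nlinarith [mul_le_mul_of_nonneg_right h1 hba.le]

lemma aux_tangent_left (f f' : ℝ → ℝ) (a b : ℝ) (hab : a < b)
    (hf : ∀ x ∈ Set.Icc a b, HasDerivAt f (f' x) x) (hm : StrictMonoOn f' (Set.Icc a b)) :
    0 < f a - f' b * (a - b) - f b := by
  obtain ⟨c, hc, hc'⟩ := exists_hasDerivAt_eq_slope f f' hab
    (fun x hx => (hf x hx).continuousAt.continuousWithinAt)
    (fun x hx => hf x (Set.Ioo_subset_Icc_self hx))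
  have h1 := hm (Set.Ioo_subset_Icc_self hc) (Set.right_mem_Icc.2 hab.le) hc.2
  have hba : 0 < b - a := sub_pos.2 hab
  rw [eq_div_iff hba.ne'] at hc'
  nlinarith [mul_lt_mul_of_pos_right h1 hba]

lemma aux_presPot_deriv (p : ℝ → ℝ) (hp : ContinuousOn p (Set.Ioi 0)) (x : ℝ) (hx : 0 < x) :
    HasDerivAt (fun y => ∫ z in (1:ℝ)..y, p z / z ^ 2) (p x / x ^ 2) x := by
  have hc : ContinuousOn (fun z => p z / z ^ 2) (Set.Ioi 0) :=
    hp.div (by fun_prop) (fun z hz => pow_ne_zero 2 (ne_of_gt hz))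
  refine intervalIntegral.integral_hasDerivAt_right ?_ ?_ ?_
  · apply ContinuousOn.intervalIntegrable
    apply hc.mono
    intro z hz
    exact lt_of_lt_of_le (lt_min one_pos hx) hz.1
  · exact hc.stronglyMeasurableAtFilter isOpen_Ioi x hx
  · exact hc.continuousAt (Ioi_mem_nhds hx)

lemma aux_bernoulli (γ : ℝ) (hγ : 1 < γ) : ∃ c > (0:ℝ), ∀ t : ℝ, 2 ≤ t →
    c * t ^ γ ≤ t ^ γ - 1 - γ * (t - 1) := by
  have h2 : 1 + γ * 1 < (1 + 1 : ℝ) ^ γ :=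
    one_add_mul_self_lt_rpow_one_add (by norm_num) (by norm_num) hγ
  have h2' : 1 + γ < (2:ℝ) ^ γ := by
    have e : (1 + 1 : ℝ) = 2 := by norm_num
    rw [e] at h2; linarith
  have hpos : (0:ℝ) < 2 ^ γ := by positivity
  refine ⟨1 - (1 + γ) / 2 ^ γ, ?_, ?_⟩
  · rw [gt_iff_lt, sub_pos, div_lt_one hpos]; exact h2'
  · intro t ht
    have h3 : 1 + γ * (t / 2 - 1) ≤ (1 + (t / 2 - 1)) ^ γ :=
      one_add_mul_self_le_rpow_one_add (by linarith) hγ.le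
    have e : t ^ γ = 2 ^ γ * (1 + (t / 2 - 1)) ^ γ := by
      rw [← Real.mul_rpow (by norm_num) (by linarith)]; congr 1; ring
    have e2 : (1 - (1 + γ) / 2 ^ γ) * t ^ γ = t ^ γ - (1 + γ) * (1 + (t / 2 - 1)) ^ γ := by
      rw [e]; field_simp
    rw [e2]
    have h4 := mul_le_mul_of_nonneg_left h3 (by linarith : 0 ≤ 1 + γ)
    nlinarith [mul_nonneg (mul_nonneg (by linarith : 0 ≤ γ) (by linarith : 0 ≤ γ - 1))
      (by linarith : 0 ≤ t - 2)]

lemma aux_lower (q : ℝ → ℝ) (γ pinf R : ℝ) (hR : 0 < R) (hq : ContinuousOn q (Set.Ioi 0))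
    (hpos : ∀ ρ > (0:ℝ), 0 < q ρ) (hpinf : 0 < pinf)
    (hlim : Filter.Tendsto (fun ρ : ℝ => q ρ / ρ ^ (γ - 1)) Filter.atTop (nhds pinf)) :
    ∃ a > (0:ℝ), ∀ z, R ≤ z → a * z ^ (γ - 1) ≤ q z := by
  obtain ⟨N, hN⟩ := Filter.eventually_atTop.1 (hlim.eventually (lt_mem_nhds (half_lt_self hpinf)))
  have hc : ContinuousOn (fun ρ : ℝ => q ρ / ρ ^ (γ - 1)) (Set.Icc R (max R N)) := by
    refine (hq.mono ?_).div ?_ ?_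
    · intro z hz; exact lt_of_lt_of_le hR hz.1
    · intro z hz
      exact (Real.continuousAt_rpow_const z (γ - 1)
        (Or.inl (lt_of_lt_of_le hR hz.1).ne')).continuousWithinAt
    · intro z hz
      exact (Real.rpow_pos_of_pos (lt_of_lt_of_le hR hz.1) _).ne'
  obtain ⟨w, hw, hw'⟩ := isCompact_Icc.exists_isMinOn
    (Set.nonempty_Icc.2 (le_max_left R N)) hc
  have hw0 : 0 < w := lt_of_lt_of_le hR hw.1
  refine ⟨min (pinf / 2) (q w / w ^ (γ - 1)), lt_min (by linarith)
    (div_pos (hpos w hw0) (Real.rpow_pos_of_pos hw0 _)), ?_⟩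
  intro z hz
  have hz0 : 0 < z := lt_of_lt_of_le hR hz
  rw [← le_div_iff₀ (Real.rpow_pos_of_pos hz0 _)]
  rcases le_total z (max R N) with h | h
  · exact (min_le_right _ _).trans (hw' ⟨hz, h⟩)
  · exact (min_le_left _ _).trans (hN z ((le_max_right _ _).trans h)).le

/-- `γ`-growth coercivity of the relative pressure potential in the residual region:
for every `δ ∈ (0,1)` there is `c(δ) > 0` with
`H(ρ) − H'(r)(ρ − r) − H(r) ≥ c(δ)(1 + ρ^γ)` whenever `δ ≤ r ≤ δ⁻¹` and `ρ > 0` lies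
outside the interval `[δ/2, 2 δ⁻¹]`. -/
theorem relative_pressure_potential_residual_coercivity
    (p : ℝ → ℝ) (γ pinf : ℝ)
    (hp1 : ContDiffOn ℝ 1 p (Set.Ici 0))
    (hp3 : ContDiffOn ℝ 3 p (Set.Ioi 0))
    (hp0 : p 0 = 0)
    (hp' : ∀ ρ > (0:ℝ), 0 < deriv p ρ)
    (hγ : (3:ℝ)/2 < γ) (hpinf : 0 < pinf)
    (hlim : Filter.Tendsto (fun ρ : ℝ => deriv p ρ / ρ ^ (γ - 1))
      Filter.atTop (nhds pinf)) :
    ∀ δ ∈ Set.Ioo (0:ℝ) 1, ∃ c > (0:ℝ), ∀ ρ r : ℝ,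
      δ ≤ r → r ≤ δ⁻¹ → 0 < ρ → ρ ∉ Set.Icc (δ/2) (2 * δ⁻¹) →
      c * (1 + ρ ^ γ) ≤ presPot p ρ - deriv (presPot p) r * (ρ - r) - presPot p r := by
  have hdp : ∀ x > (0:ℝ), HasDerivAt p (deriv p x) x := fun x hx =>
    ((hp3.contDiffAt (Ioi_mem_nhds hx)).differentiableAt (by norm_num)).hasDerivAt
  have hcp : ContinuousOn p (Set.Ioi 0) := hp3.continuousOn
  have hcd : ContinuousOn (deriv p) (Set.Ioi 0) :=
    hp3.continuousOn_deriv_of_isOpen isOpen_Ioi (by norm_num)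
  set H := presPot p with hH
  set h : ℝ → ℝ := fun x => (∫ z in (1:ℝ)..x, p z / z ^ 2) + p x / x with hh
  have hHd : ∀ x > (0:ℝ), HasDerivAt H (h x) x := by
    intro x hx
    have := (hasDerivAt_id x).mul (aux_presPot_deriv p hcp x hx)
    refine this.congr_deriv ?_
    simp only [hh, id]
    field_simp
  have hhd : ∀ x > (0:ℝ), HasDerivAt h (deriv p x / x) x := by
    intro x hx
    have := (aux_presPot_deriv p hcp x hx).add ((hdp x hx).div (hasDerivAt_id x) hx.ne')
    refine this.congr_deriv ?_
    simp only [id]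
    field_simp
    ring
  have hmono : StrictMonoOn h (Set.Ioi 0) := by
    refine strictMonoOn_of_deriv_pos (convex_Ioi 0)
      (fun x hx => (hhd x hx).continuousAt.continuousWithinAt) ?_
    intro x hx
    rw [interior_Ioi] at hx
    rw [(hhd x hx).deriv]
    exact div_pos (hp' x hx) hx
  have hE : ∀ x > (0:ℝ), ∀ y > (0:ℝ), 0 ≤ H y - h x * (y - x) - H x := by
    intro x hx y hy
    rcases lt_trichotomy x y with hxy | hxy | hxy
    · exact aux_tangent_right H h x y hxy (fun z hz => hHd z (lt_of_lt_of_le hx hz.1))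
        (hmono.monotoneOn.mono fun z hz => lt_of_lt_of_le hx hz.1)
    · subst hxy; simp
    · exact (aux_tangent_left H h y x hxy (fun z hz => hHd z (lt_of_lt_of_le hy hz.1))
        (hmono.mono fun z hz => lt_of_lt_of_le hy hz.1)).le
  rintro δ ⟨hδ0, hδ1⟩
  have hR1 : 1 < δ⁻¹ := (one_lt_inv₀ hδ0).2 hδ1
  generalize hRdef : δ⁻¹ = R at hR1
  have hR : 0 < R := by linarith
  obtain ⟨a, ha, hap⟩ := aux_lower (deriv p) γ pinf R hR hcd hp' hpinf hlim
  obtain ⟨k, hk, hkt⟩ := aux_bernoulli γ (by linarith)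
  have hγ1 : 0 < γ - 1 := by linarith
  have hγ0 : 0 < γ := by linarith
  set b := a / (γ * (γ - 1)) with hb
  have hb0 : 0 < b := by positivity
  -- the left constant
  have hm0 : 0 < H (δ / 2) - h δ * (δ / 2 - δ) - H δ :=
    aux_tangent_left H h (δ / 2) δ (by linarith)
      (fun z hz => hHd z (lt_of_lt_of_le (by linarith) hz.1))
      (hmono.mono fun z hz => lt_of_lt_of_le (by linarith : 0 < δ / 2) hz.1)
  set m := H (δ / 2) - h δ * (δ / 2 - δ) - H δ with hm
  -- the right estimate
  have hright : ∀ ρ, 2 * R ≤ ρ → b * k * ρ ^ γ ≤ H ρ - h R * (ρ - R) - H R := by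
    intro ρ hρ
    have hpow : ∀ x > (0:ℝ), HasDerivAt (fun y => H y - b * y ^ γ)
        (h x - b * (γ * x ^ (γ - 1))) x := fun x hx =>
      (hHd x hx).sub ((Real.hasDerivAt_rpow_const (Or.inl (ne_of_gt hx))).const_mul b)
    have hpow2 : ∀ x > (0:ℝ), HasDerivAt (fun y => h y - b * (γ * y ^ (γ - 1)))
        (deriv p x / x - b * (γ * ((γ - 1) * x ^ (γ - 1 - 1)))) x := fun x hx =>
      (hhd x hx).sub (((Real.hasDerivAt_rpow_const
        (Or.inl (ne_of_gt hx))).const_mul γ).const_mul b)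
    have hmon : MonotoneOn (fun y => h y - b * (γ * y ^ (γ - 1))) (Set.Icc R ρ) := by
      refine monotoneOn_of_deriv_nonneg (convex_Icc R ρ)
        (fun x hx => (hpow2 x (lt_of_lt_of_le hR hx.1)).continuousAt.continuousWithinAt)
        (fun x hx => (hpow2 x (lt_of_lt_of_le hR
          (interior_subset hx).1)).differentiableAt.differentiableWithinAt) ?_
      intro x hx
      have hx' := interior_subset hx
      have hx0 : 0 < x := lt_of_lt_of_le hR hx'.1
      rw [(hpow2 x hx0).deriv, Real.rpow_sub_one hx0.ne' (γ - 1)]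
      have e : b * (γ * ((γ - 1) * (x ^ (γ - 1) / x))) = a * x ^ (γ - 1) / x := by
        rw [hb]; field_simp
      rw [e, sub_nonneg]
      exact div_le_div_of_nonneg_right (hap x hx'.1) hx0.le
    have h1 := aux_tangent_right _ _ R ρ (by linarith)
      (fun x hx => hpow x (lt_of_lt_of_le hR hx.1)) hmon
    have h2 := hkt (ρ / R) (by rw [le_div_iff₀ hR]; exact hρ)
    have hRp : 0 < R ^ γ := Real.rpow_pos_of_pos hR _
    rw [Real.div_rpow (by linarith) hR.le] at h2
    have h3 := mul_le_mul_of_nonneg_left h2 (mul_pos hb0 hRp).le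
    have e1 : b * R ^ γ * (k * (ρ ^ γ / R ^ γ)) = b * k * ρ ^ γ := by field_simp
    have e2 : b * R ^ γ * (ρ ^ γ / R ^ γ - 1 - γ * (ρ / R - 1))
        = b * ρ ^ γ - b * R ^ γ - b * (γ * (R ^ γ / R)) * (ρ - R) := by field_simp
    rw [e1, e2] at h3
    simp only [Real.rpow_sub_one hR.ne'] at h1
    linarith
  refine ⟨min (m / 2) (b * k / 2), lt_min (by linarith) (by positivity), ?_⟩
  intro ρ r hδr hrR hρ hout
  have hr : 0 < r := by linarith
  rw [(hHd r hr).deriv]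
  have hργ : 0 < ρ ^ γ := Real.rpow_pos_of_pos hρ _
  rcases lt_or_ge ρ (δ / 2) with hlt | hge
  · have hle1 : ρ ^ γ ≤ 1 := Real.rpow_le_one hρ.le (by linarith) hγ0.le
    have hc : min (m / 2) (b * k / 2) * (1 + ρ ^ γ) ≤ m / 2 * 2 :=
      mul_le_mul (min_le_left _ _) (by linarith) (by linarith) (by linarith)
    have hδ2 : 0 < δ / 2 := by linarith
    have m1 : h (δ / 2) ≤ h r := hmono.monotoneOn hδ2 hr (by linarith)
    have m2 : h δ ≤ h r := hmono.monotoneOn hδ0 hr hδr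
    have t1 := hE (δ / 2) hδ2 ρ hρ
    have t2 := hE r hr δ hδ0
    have t3 := mul_nonneg (sub_nonneg.2 m1) (sub_nonneg.2 hlt.le)
    have t4 := mul_nonneg (sub_nonneg.2 m2) hδ2.le
    nlinarith
  · have hgt : 2 * R < ρ := by
      by_contra hcon
      exact hout ⟨hge, by linarith⟩
    have hge1 : 1 ≤ ρ ^ γ := Real.one_le_rpow (by linarith) hγ0.le
    have hc : min (m / 2) (b * k / 2) * (1 + ρ ^ γ) ≤ b * k / 2 * (2 * ρ ^ γ) :=
      mul_le_mul (min_le_right _ _) (by linarith) (by linarith) (by positivity)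
    have t1 := hright ρ hgt.le
    have t2 := hE r hr R hR
    have m1 : h r ≤ h R := hmono.monotoneOn hr hR hrR
    have t3 := mul_nonneg (sub_nonneg.2 m1) (by linarith : 0 ≤ ρ - R)
    nlinarith
end
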